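/- arXiv:0907.2141 — 3 statements merged into one kernel-verified Lean document; each statement's English description precedes it below -/
import Mathlib

section
/- Let k be a field and C a finite EI category, and suppose every composable chain of non-isomorphisms in C has length at most n (i.e. ℓ(C) ≤ n). Then every representation M : C ⥤ ModuleCat k that has finite projective dimension has projective dimension at most n. -/
open CategoryTheory CategoryTheory.Limits

/-- An object `M` of an abelian-like category has projective dimension at most `n`
if it admits a projective resolution whose terms vanish in degrees `> n`. -/
def HasProjDimLE {A : Type*} [Category A] [HasZeroObject A] [HasZeroMorphisms A]
    (M : A) (n : ℕ) : Prop :=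
  ∃ P : ProjectiveResolution M, ∀ i, n < i → IsZero (P.complex.X i)

universe u v w

namespace EIRepresentation

section ProjectiveDimension

variable {A : Type u} [Category.{v} A] [Abelian A]

lemma hasProjectiveDimensionLE_of_hasProjDimLE {M : A} {m : ℕ} (h : HasProjDimLE M m) :
    HasProjectiveDimensionLE M m := by
  obtain ⟨P, hP⟩ := h
  let := HasExt.standard A
  refine HasProjectiveDimensionLT.mk fun i hi Y e ↦ ?_
  obtain ⟨f, hf, rfl⟩ := P.extMk_surjective e (i + 1) rfl
  obtain rfl : f = 0 := (hP i hi).eq_of_src _ _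
  simp

/-- A projective resolution of `S.X₁` is spliced with a short exact sequence whose middle
term is projective. -/
lemma hasProjDimLE_succ_of_shortExact {S : ShortComplex A} (hS : S.ShortExact)
    (hP : Projective S.X₂) {n : ℕ} (h : HasProjDimLE S.X₁ n) : HasProjDimLE S.X₃ (n + 1) := by
  obtain ⟨Q, hQ⟩ := h
  have := hS.mono_f
  have := hS.epi_g
  have hπ : Epi (Q.π.f 0) := inferInstance
  obtain ⟨e, _, he, hex⟩ : ∃ (e : Q.complex.X 0 ⟶ S.X₁) (_ : Epi e)
      (h : Q.complex.d 1 0 ≫ e = 0), (ShortComplex.mk _ _ h).Exact :=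
    ⟨Q.π.f 0, hπ, Q.complex_d_comp_π_f_zero, Q.exact₀⟩
  have w : Q.complex.d 1 0 ≫ e ≫ S.f = 0 := by
    rw [← Category.assoc, he, zero_comp]
  have w' : (e ≫ S.f) ≫ S.g = 0 := by simp
  let K := ChainComplex.augment Q.complex (e ≫ S.f) w
  have exact_zero : (ShortComplex.mk (e ≫ S.f) S.g w').Exact := by
    let φ : ShortComplex.mk (e ≫ S.f) S.g w' ⟶ S :=
      { τ₁ := e, τ₂ := 𝟙 _, τ₃ := 𝟙 _ }
    have : Epi φ.τ₁ := inferInstanceAs (Epi e)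
    have : IsIso φ.τ₂ := inferInstanceAs (IsIso (𝟙 _))
    have : Mono φ.τ₃ := inferInstanceAs (Mono (𝟙 _))
    exact (ShortComplex.exact_iff_of_epi_of_isIso_of_mono φ).2 hS.exact
  have exact_one : (ShortComplex.mk (Q.complex.d 1 0) (e ≫ S.f) w).Exact := by
    let φ : ShortComplex.mk _ _ he ⟶ ShortComplex.mk _ _ w :=
      { τ₁ := 𝟙 _, τ₂ := 𝟙 _, τ₃ := S.f }
    have : Epi φ.τ₁ := inferInstanceAs (Epi (𝟙 _))
    have : IsIso φ.τ₂ := inferInstanceAs (IsIso (𝟙 _))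
    have : Mono φ.τ₃ := inferInstanceAs (Mono S.f)
    exact (ShortComplex.exact_iff_of_epi_of_isIso_of_mono φ).1 hex
  have hK : K.d 1 0 ≫ S.g = 0 := w'
  refine ⟨{ complex := K
            projective := ?_
            π := (ChainComplex.toSingle₀Equiv _ _).symm ⟨S.g, hK⟩
            quasiIso := ⟨fun i ↦ ?_⟩ }, ?_⟩
  · rintro (_ | i)
    · exact hP
    · exact Q.projective i
  · cases i with
    | zero =>
      rw [ChainComplex.quasiIsoAt₀_iff, ShortComplex.quasiIso_iff_of_zeros']
      · refine (ShortComplex.exact_and_epi_g_iff_of_iso ?_).2 ⟨exact_zero, hS.epi_g⟩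
        exact ShortComplex.isoMk (Iso.refl _) (Iso.refl _) (Iso.refl _)
          ((Category.id_comp _).trans (Category.comp_id _).symm)
          (.trans (Category.id_comp _) (.trans
            (ChainComplex.toSingle₀Equiv_symm_apply_f_zero (C := K) S.g hK).symm
            (Category.comp_id _).symm))
      all_goals rfl
    | succ i =>
      rw [quasiIsoAt_iff_exactAt']
      · rw [HomologicalComplex.exactAt_iff' _ (i + 1 + 1) (i + 1) i (by simp) (by simp)]
        cases i with
        | zero => exact exact_one
        | succ i => exact Q.exact_succ i
      · apply ChainComplex.exactAt_succ_single_obj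
  · rintro (_ | i) hi
    · omega
    · exact hQ i (by omega)

lemma hasProjDimLE_of_hasProjectiveDimensionLE [EnoughProjectives A] {n : ℕ} {M : A}
    (h : HasProjectiveDimensionLE M n) : HasProjDimLE M n := by
  induction n generalizing M with
  | zero =>
    have : Projective M := (projective_iff_hasProjectiveDimensionLE_zero M).2 h
    refine ⟨ProjectiveResolution.self M, fun i hi ↦ ?_⟩
    exact HomologicalComplex.isZero_single_obj_X _ _ _ _ hi.ne'
  | succ n ih =>
    have hS : (ShortComplex.mk (kernel.ι (Projective.π M)) (Projective.π M)
        (by simp)).ShortExact :=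
      { exact := ShortComplex.exact_of_f_is_kernel _ (kernelIsKernel _) }
    exact hasProjDimLE_succ_of_shortExact hS (Projective.projective_over M)
      (ih ((hS.hasProjectiveDimensionLT_X₃_iff n (Projective.projective_over M)).1 h))

end ProjectiveDimension

variable {k : Type u} [Field k] {C : Type} [SmallCategory C]

section Induced

open DirectSum

open Classical in
lemma directSum_lof_congr (V : C → ModuleCat.{w} k) {x z : C} {f g : x ⟶ z} (h : f = g)
    (m : V x) :
    DirectSum.lof k (Σ x : C, (x ⟶ z)) (fun p ↦ V p.1) ⟨x, f⟩ m =
      DirectSum.lof k (Σ x : C, (x ⟶ z)) (fun p ↦ V p.1) ⟨x, g⟩ m := by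
  rw [h]

open Classical in
/-- The representation freely generated by a family of vector spaces indexed by the objects. -/
noncomputable def induced (V : C → ModuleCat.{w} k) : C ⥤ ModuleCat.{w} k where
  obj z := ModuleCat.of k (⨁ p : (Σ x : C, (x ⟶ z)), V p.1)
  map {z z'} h := ModuleCat.ofHom (DirectSum.toModule k (Σ x : C, (x ⟶ z)) _
    fun p ↦ DirectSum.lof k (Σ x : C, (x ⟶ z')) (fun q ↦ V q.1) ⟨p.1, p.2 ≫ h⟩)
  map_id z := by
    ext : 1
    refine DirectSum.linearMap_ext _ fun p ↦ LinearMap.ext fun m ↦ ?_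
    simpa [DirectSum.toModule_lof] using directSum_lof_congr V (Category.comp_id p.2) m
  map_comp f g := by
    ext : 1
    refine DirectSum.linearMap_ext _ fun p ↦ LinearMap.ext fun m ↦ ?_
    simpa [DirectSum.toModule_lof] using directSum_lof_congr V (Category.assoc p.2 f g).symm m

variable {V : C → ModuleCat.{w} k} {M N : C ⥤ ModuleCat.{w} k}

open Classical in
/-- The inclusion of the summand of `(induced V).obj z` indexed by `f : x ⟶ z`. -/
noncomputable def inducedι (V : C → ModuleCat.{w} k) {x z : C} (f : x ⟶ z) :
    V x →ₗ[k] (induced V).obj z :=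
  DirectSum.lof k (Σ x : C, (x ⟶ z)) (fun p ↦ V p.1) ⟨x, f⟩

/-- The projection to the summand of `(induced V).obj z` indexed by `f : x ⟶ z`. -/
noncomputable def inducedComponent (V : C → ModuleCat.{w} k) {x z : C} (f : x ⟶ z) :
    (induced V).obj z →ₗ[k] V x :=
  DirectSum.component k (Σ x : C, (x ⟶ z)) (fun p ↦ V p.1) ⟨x, f⟩

open Classical in
lemma inducedComponent_ι_self {x z : C} (f : x ⟶ z) (m : V x) :
    inducedComponent V f (inducedι V f m) = m :=
  DirectSum.component.lof_self ..

open Classical in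
lemma inducedComponent_ι_of_ne {x y z : C} {f : x ⟶ z} {g : y ⟶ z} (m : V x)
    (h : (⟨x, f⟩ : Σ x : C, (x ⟶ z)) ≠ ⟨y, g⟩) :
    inducedComponent V g (inducedι V f m) = 0 :=
  (DirectSum.component.of ..).trans (dif_neg h)

open Classical in
@[simp]
lemma induced_map_ι {x z z' : C} (f : x ⟶ z) (h : z ⟶ z') (m : V x) :
    ((induced V).map h).hom (inducedι V f m) = inducedι V (f ≫ h) m :=
  DirectSum.toModule_lof (N := ⨁ p : (Σ x : C, (x ⟶ z')), V p.1) ..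

open Classical in
lemma induced_hom_ext {z : C} {W : Type*} [AddCommGroup W] [Module k W]
    {a b : (induced V).obj z →ₗ[k] W}
    (h : ∀ (x : C) (f : x ⟶ z) (m : V x), a (inducedι V f m) = b (inducedι V f m)) : a = b :=
  DirectSum.linearMap_ext _ fun p ↦ LinearMap.ext fun m ↦ h p.1 p.2 m

open Classical in
/-- The morphism out of `induced V` determined by its values on generators. -/
noncomputable def inducedDesc (a : ∀ x, V x →ₗ[k] N.obj x) : induced V ⟶ N where
  app z := ModuleCat.ofHom (DirectSum.toModule k (Σ x : C, (x ⟶ z)) _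
    fun p ↦ (N.map p.2).hom ∘ₗ a p.1)
  naturality z z' h := by
    ext : 1
    refine induced_hom_ext fun x f m ↦ ?_
    have e (z : C) (f : x ⟶ z) : DirectSum.toModule k (Σ x : C, (x ⟶ z)) _
        (fun p ↦ (N.map p.2).hom ∘ₗ a p.1) (inducedι V f m) = (N.map f).hom (a x m) :=
      DirectSum.toModule_lof ..
    refine ((congrArg _ (induced_map_ι f h m)).trans (e z' (f ≫ h))).trans
      (.trans ?_ (congrArg (N.map h).hom (e z f)).symm)
    simp

open Classical in
@[simp]
lemma inducedDesc_app_ι (a : ∀ x, V x →ₗ[k] N.obj x) {x z : C} (f : x ⟶ z) (m : V x) :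
    ((inducedDesc a).app z).hom (inducedι V f m) = (N.map f).hom (a x m) :=
  DirectSum.toModule_lof ..

lemma induced_natTrans_ext {α β : induced V ⟶ N}
    (h : ∀ (x : C) (m : V x),
      (α.app x).hom (inducedι V (𝟙 x) m) = (β.app x).hom (inducedι V (𝟙 x) m)) : α = β := by
  ext z : 3
  refine induced_hom_ext fun x f m ↦ ?_
  have e : inducedι V f m = ((induced V).map f).hom (inducedι V (𝟙 x) m) := by simp
  rw [e, NatTrans.naturality_apply, NatTrans.naturality_apply]
  exact congrArg _ (h x m)

instance projective_induced (V : C → ModuleCat.{w} k) : Projective (induced V) where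
  factors {E X} f e _ := by
    have he (x : C) : Function.Surjective (e.app x).hom :=
      (ModuleCat.epi_iff_surjective _).1 ((NatTrans.epi_iff_epi_app e).1 inferInstance x)
    choose s hs using fun x ↦ LinearMap.exists_rightInverse_of_surjective (e.app x).hom
      (LinearMap.range_eq_top.2 (he x))
    refine ⟨inducedDesc fun x ↦ s x ∘ₗ (f.app x).hom ∘ₗ inducedι V (𝟙 x), ?_⟩
    refine induced_natTrans_ext fun x m ↦ ?_
    simpa using LinearMap.congr_fun (hs x) _

/-- The canonical morphism from the representation generated by the values of `M` to `M`. -/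
noncomputable def counit (M : C ⥤ ModuleCat.{w} k) : induced M.obj ⟶ M :=
  inducedDesc fun _ ↦ LinearMap.id

@[simp]
lemma counit_app_ι {x z : C} (f : x ⟶ z) (m : M.obj x) :
    ((counit M).app z).hom (inducedι M.obj f m) = (M.map f).hom m :=
  inducedDesc_app_ι _ f m

instance (M : C ⥤ ModuleCat.{w} k) : Epi (counit M) := by
  rw [NatTrans.epi_iff_epi_app]
  intro z
  rw [ModuleCat.epi_iff_surjective]
  exact fun m ↦ ⟨inducedι M.obj (𝟙 z) m, (counit_app_ι ..).trans (by simp)⟩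

instance : EnoughProjectives (C ⥤ ModuleCat.{w} k) where
  presentation M := ⟨{ p := induced M.obj, f := counit M }⟩

end Induced

section Support

/-- Every morphism to `z` from an object satisfying `U` is an isomorphism. -/
def IsMinimalFor (U : C → Prop) (z : C) : Prop :=
  ∀ (x : C) (f : x ⟶ z), U x → IsIso f

lemma IsMinimalFor.of_iso {U : C → Prop} {z y : C} (hz : IsMinimalFor U z) (u : y ≅ z) :
    IsMinimalFor U y := fun x f hx ↦ by
  have := hz x (f ≫ u.hom) hx
  exact IsIso.of_isIso_comp_right f u.hom

/-- `M` vanishes outside of `U`. -/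
def SupportedOn (U : C → Prop) (M : C ⥤ ModuleCat.{w} k) : Prop :=
  ∀ x, ¬ U x → Subsingleton (M.obj x)

variable {L M : C ⥤ ModuleCat.{w} k}

lemma SupportedOn.induced {U : C → Prop} (hU : ∀ (x z : C), (x ⟶ z) → U x → U z)
    (hM : SupportedOn U M) : SupportedOn U (induced M.obj) := fun z hz ↦ by
  refine subsingleton_of_forall_eq 0 fun t ↦ ?_
  refine LinearMap.congr_fun (f := LinearMap.id) (g := 0) (induced_hom_ext fun x f m ↦ ?_) t
  have := hM x fun hx ↦ hz (hU x z f hx)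
  rw [Subsingleton.elim m 0]
  simp

lemma SupportedOn.of_mono {U : C → Prop} (hM : SupportedOn U M) (f : L ⟶ M) [Mono f] :
    SupportedOn U L := fun z hz ↦
  have := hM z hz
  ((ModuleCat.mono_iff_injective _).1
    ((NatTrans.mono_iff_mono_app f).1 inferInstance z)).subsingleton

end Support

section IsoAverage

variable [∀ z : C, Fintype (Σ y : C, (y ≅ z))] {L M N : C ⥤ ModuleCat.{w} k}

/-- The sum of all conjugates of a family of linear maps under isomorphisms with target `z`. -/
noncomputable def isoAverage (φ : ∀ x, M.obj x →ₗ[k] N.obj x) (z : C) : M.obj z →ₗ[k] N.obj z :=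
  ∑ p : (Σ y : C, (y ≅ z)), (N.map p.2.hom).hom ∘ₗ φ p.1 ∘ₗ (M.map p.2.inv).hom

lemma isoAverage_apply (φ : ∀ x, M.obj x →ₗ[k] N.obj x) (z : C) (m : M.obj z) :
    isoAverage φ z m =
      ∑ p : (Σ y : C, (y ≅ z)), (N.map p.2.hom).hom (φ p.1 ((M.map p.2.inv).hom m)) := by
  simp [isoAverage]

lemma isoAverage_map (φ : ∀ x, M.obj x →ₗ[k] N.obj x) {z z' : C} (u : z ≅ z') (m : M.obj z) :
    isoAverage φ z' ((M.map u.hom).hom m) = (N.map u.hom).hom (isoAverage φ z m) := by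
  rw [isoAverage_apply, isoAverage_apply, map_sum]
  let e : (Σ y : C, (y ≅ z)) ≃ (Σ y : C, (y ≅ z')) :=
    { toFun p := ⟨p.1, p.2 ≪≫ u⟩
      invFun p := ⟨p.1, p.2 ≪≫ u.symm⟩
      left_inv p := by simp
      right_inv p := by simp }
  refine (Fintype.sum_equiv e _ _ fun p ↦ ?_).symm
  simp [e, ← ModuleCat.comp_apply, ← Functor.map_comp]

lemma isoAverage_comp_left (φ : ∀ x, L.obj x →ₗ[k] M.obj x) (g : M ⟶ N) (z : C) (m : L.obj z) :
    isoAverage (fun x ↦ (g.app x).hom ∘ₗ φ x) z m = (g.app z).hom (isoAverage φ z m) := by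
  simp [isoAverage_apply, NatTrans.naturality_apply]

lemma isoAverage_comp_right (φ : ∀ x, M.obj x →ₗ[k] N.obj x) (f : ∀ x, L.obj x →ₗ[k] M.obj x)
    (z : C) (m : L.obj z)
    (hf : ∀ (y : C) (u : y ≅ z),
      f y ((L.map u.inv).hom m) = (M.map u.inv).hom (f z m)) :
    isoAverage (fun x ↦ φ x ∘ₗ f x) z m = isoAverage φ z (f z m) := by
  simp [isoAverage_apply, hf]

/-- A form of Higman's criterion for relative projectivity, at the objects which are minimal
for `U`: the identity is an average over isomorphisms. -/
def IsRelativelyProjective (U : C → Prop) (M : C ⥤ ModuleCat.{w} k) : Prop :=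
  ∃ φ : ∀ x, M.obj x →ₗ[k] M.obj x, ∀ z, IsMinimalFor U z → ∀ m, isoAverage φ z m = m

lemma isoAverage_inducedComponent {U : C → Prop} (hM : SupportedOn U M) {z : C}
    (hz : IsMinimalFor U z) (t : (induced M.obj).obj z) :
    isoAverage (M := induced M.obj) (N := M) (fun x ↦ inducedComponent M.obj (𝟙 x)) z t =
      ((counit M).app z).hom t := by
  refine LinearMap.congr_fun (induced_hom_ext fun x f m ↦ ?_) t
  by_cases hx : U x
  · have := hz x f hx
    rw [isoAverage_apply, counit_app_ι, Finset.sum_eq_single ⟨x, asIso f⟩ _ (by simp)]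
    · rw [induced_map_ι]
      simp [inducedComponent_ι_self]
    · rintro ⟨y, g⟩ - hy
      rw [induced_map_ι, inducedComponent_ι_of_ne, map_zero]
      intro h
      obtain ⟨rfl, h⟩ := Sigma.mk.inj h
      refine hy ?_
      congr 1
      ext
      rw [← cancel_mono g.inv]
      simpa using (eq_of_heq h).symm
  · have := hM x hx
    rw [Subsingleton.elim m 0]
    simp

lemma isRelativelyProjective_of_projective {U : C → Prop} (hM : SupportedOn U M)
    [Projective M] : IsRelativelyProjective U M := by
  let s : M ⟶ induced M.obj := Projective.factorThru (𝟙 M) (counit M)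
  have hs : s ≫ counit M = 𝟙 M := Projective.factorThru_comp _ _
  refine ⟨fun x ↦ inducedComponent M.obj (𝟙 x) ∘ₗ (s.app x).hom, fun z hz m ↦ ?_⟩
  rw [isoAverage_comp_right (M := induced M.obj) _ (fun x ↦ (s.app x).hom) z m
    (fun y u ↦ NatTrans.naturality_apply s u.inv m),
    isoAverage_inducedComponent hM hz]
  exact congrArg (fun α ↦ (α.app z).hom m) hs

lemma isRelativelyProjective_of_shortExact {U : C → Prop} {S : ShortComplex (C ⥤ ModuleCat.{w} k)}
    (hS : S.ShortExact) (h₁ : IsRelativelyProjective U S.X₁)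
    (h₂ : IsRelativelyProjective U S.X₂) : IsRelativelyProjective U S.X₃ := by
  obtain ⟨φ, hφ⟩ := h₁
  obtain ⟨χ, hχ⟩ := h₂
  have hS' (x : C) : (S.map ((evaluation C (ModuleCat k)).obj x)).ShortExact :=
    hS.map_of_exact _
  have hinj (x : C) : Function.Injective (S.f.app x).hom := (hS' x).moduleCat_injective_f
  have hsurj (x : C) : Function.Surjective (S.g.app x).hom := (hS' x).moduleCat_surjective_g
  have hexact (x : C) (t : S.X₂.obj x) (ht : (S.g.app x).hom t = 0) :
      ∃ a, (S.f.app x).hom a = t :=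
    (ShortComplex.moduleCat_exact_iff _).1 (hS' x).exact t ht
  have hzero (x : C) (a : S.X₁.obj x) : (S.g.app x).hom ((S.f.app x).hom a) = 0 :=
    congrArg (fun α ↦ (α.app x).hom a) S.zero
  choose r hr using fun x ↦ LinearMap.exists_leftInverse_of_injective (S.f.app x).hom
    (LinearMap.ker_eq_bot.2 (hinj x))
  choose σ hσ using fun x ↦ LinearMap.exists_rightInverse_of_surjective (S.g.app x).hom
    (LinearMap.range_eq_top.2 (hsurj x))
  let R (z : C) : S.X₂.obj z →ₗ[k] S.X₁.obj z := isoAverage (fun x ↦ φ x ∘ₗ r x) z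
  have hR (z : C) (hz : IsMinimalFor U z) (a : S.X₁.obj z) : R z ((S.f.app z).hom a) = a := by
    conv_rhs => rw [← hφ z hz a]
    simp only [R]
    rw [← isoAverage_comp_right (L := S.X₁) _ (fun x ↦ (S.f.app x).hom) z a
      (fun y u ↦ NatTrans.naturality_apply S.f u.inv a)]
    congr 2
    funext x
    rw [LinearMap.comp_assoc, hr, LinearMap.comp_id]
  let s (z : C) : S.X₃.obj z →ₗ[k] S.X₂.obj z := σ z - (S.f.app z).hom ∘ₗ R z ∘ₗ σ z
  have hgs (z : C) (m : S.X₃.obj z) : (S.g.app z).hom (s z m) = m := by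
    simp only [s, LinearMap.sub_apply, LinearMap.comp_apply, map_sub, hzero, sub_zero]
    exact LinearMap.congr_fun (hσ z) m
  have hRs (z : C) (hz : IsMinimalFor U z) (m : S.X₃.obj z) : R z (s z m) = 0 := by
    simp [s, hR z hz]
  refine ⟨fun x ↦ (S.g.app x).hom ∘ₗ χ x ∘ₗ s x, fun z hz m ↦ ?_⟩
  rw [isoAverage_comp_left (M := S.X₂), isoAverage_comp_right, hχ z hz, hgs]
  intro y u
  have hy := hz.of_iso u
  obtain ⟨a, ha⟩ := hexact y (s y ((S.X₃.map u.inv).hom m) - (S.X₂.map u.inv).hom (s z m)) (by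
    rw [map_sub, hgs, sub_eq_zero]
    exact ((NatTrans.naturality_apply S.g u.inv (s z m)).trans
      (congrArg _ (hgs z m))).symm)
  have ha' : a = 0 := by
    rw [← hR y hy a, ha, map_sub, hRs y hy, zero_sub, neg_eq_zero]
    exact (isoAverage_map _ u.symm (s z m)).trans ((congrArg _ (hRs z hz m)).trans (map_zero _))
  rw [ha', map_zero] at ha
  exact sub_eq_zero.1 ha.symm

lemma isRelativelyProjective_of_hasProjectiveDimensionLE {U : C → Prop}
    (hU : ∀ (x z : C), (x ⟶ z) → U x → U z) {n : ℕ} (hM : SupportedOn U M)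
    (h : HasProjectiveDimensionLE M n) : IsRelativelyProjective U M := by
  induction n generalizing M with
  | zero =>
    have : Projective M := (projective_iff_hasProjectiveDimensionLE_zero M).2 h
    exact isRelativelyProjective_of_projective hM
  | succ n ih =>
    have hS : (ShortComplex.mk (kernel.ι (counit M)) (counit M) (by simp)).ShortExact :=
      { exact := ShortComplex.exact_of_f_is_kernel _ (kernelIsKernel _) }
    have hI := hM.induced hU
    exact isRelativelyProjective_of_shortExact hS
      (ih (hI.of_mono (kernel.ι (counit M)))
        ((hS.hasProjectiveDimensionLT_X₃_iff n (projective_induced _)).1 h))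
      (isRelativelyProjective_of_projective hI)

/-- A representation supported on `U` and relatively projective at the minimal objects is a quotient
of a projective representation by a subrepresentation vanishing at these objects. -/
lemma IsRelativelyProjective.exists_epi {U : C → Prop} (hM : SupportedOn U M)
    (h : IsRelativelyProjective U M) :
    ∃ (P : C ⥤ ModuleCat.{w} k) (π : P ⟶ M), Projective P ∧ Epi π ∧
      SupportedOn (fun z ↦ ¬ IsMinimalFor U z) (kernel π) := by
  classical
  obtain ⟨φ, hφ⟩ := h
  let s (x : C) : M.obj x →ₗ[k] (induced M.obj).obj x :=
    if IsMinimalFor U x then isoAverage (fun x ↦ inducedι M.obj (𝟙 x) ∘ₗ φ x) x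
    else inducedι M.obj (𝟙 x)
  have hs (x : C) (hx : IsMinimalFor U x) :
      s x = isoAverage (fun x ↦ inducedι M.obj (𝟙 x) ∘ₗ φ x) x := if_pos hx
  have hcs (x : C) (m : M.obj x) : ((counit M).app x).hom (s x m) = m := by
    by_cases hx : IsMinimalFor U x
    · rw [hs x hx, ← isoAverage_comp_left]
      conv_rhs => rw [← hφ x hx m]
      congr 2
      ext y m
      simp
    · simp [s, hx]
  let e : induced M.obj ⟶ induced M.obj := inducedDesc s
  have hsc (z : C) (hz : IsMinimalFor U z) (t : (induced M.obj).obj z) :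
      (e.app z).hom t = s z (((counit M).app z).hom t) := by
    refine LinearMap.congr_fun (f := (e.app z).hom) (g := s z ∘ₗ ((counit M).app z).hom)
      (induced_hom_ext fun x f m ↦ ?_) t
    by_cases hx : U x
    · have := hz x f hx
      have hx' := hz.of_iso (asIso f)
      rw [LinearMap.comp_apply, counit_app_ι, inducedDesc_app_ι, hs x hx', hs z hz]
      exact (isoAverage_map _ (asIso f) m).symm
    · have := hM x hx
      rw [Subsingleton.elim m 0]
      simp
  have hes (x : C) (m : M.obj x) : (e.app x).hom (s x m) = s x m := by
    by_cases hx : IsMinimalFor U x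
    · rw [hsc x hx, hcs]
    · have hx' : s x = inducedι M.obj (𝟙 x) := if_neg hx
      conv_lhs => rw [hx', inducedDesc_app_ι]
      simp
  have hee : e ≫ e = e := induced_natTrans_ext fun x m ↦ by
    have : (e.app x).hom (inducedι M.obj (𝟙 x) m) = s x m := by simp [e]
    rw [NatTrans.comp_app, ModuleCat.hom_comp, LinearMap.comp_apply, this, hes]
  have hec : e ≫ counit M = counit M := induced_natTrans_ext fun x m ↦ by
    simp [e, hcs]
  obtain ⟨P, i, p, hip, hpi⟩ := IsIdempotentComplete.idempotents_split _ e hee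
  have hie : i ≫ e = i := by rw [← hpi, reassoc_of% hip]
  refine ⟨P, i ≫ counit M, (Retract.mk i p hip).projective, ?_, fun z hz ↦ ?_⟩
  · exact epi_of_epi_fac (f := p) (h := counit M) (by rw [reassoc_of% hpi, hec])
  · rw [not_not] at hz
    refine subsingleton_of_forall_eq 0 fun a ↦ ?_
    let q : P.obj z := ((kernel.ι (i ≫ counit M)).app z).hom a
    have hq : ((counit M).app z).hom ((i.app z).hom q) = 0 :=
      congrArg (fun α ↦ (α.app z).hom a) (kernel.condition (i ≫ counit M))
    have hiq : (i.app z).hom q = 0 := by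
      have : (e.app z).hom ((i.app z).hom q) = (i.app z).hom q :=
        congrArg (fun α ↦ (α.app z).hom q) hie
      rw [← this, hsc z hz, hq, map_zero]
    have hq0 : q = 0 := by
      have : (p.app z).hom ((i.app z).hom q) = q := congrArg (fun α ↦ (α.app z).hom q) hip
      rw [← this, hiq, map_zero]
    exact (ModuleCat.mono_iff_injective _).1 ((NatTrans.mono_iff_mono_app
      (kernel.ι (i ≫ counit M))).1 inferInstance z) (hq0.trans (map_zero _).symm)

end IsoAverage

section Levels

/-- In an EI category, a morphism with a composite that is an isomorphism is an isomorphism. -/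
lemma isIso_of_isIso_comp (hEI : ∀ (x : C) (f : x ⟶ x), IsIso f) {x y z : C} (f : x ⟶ y)
    (g : y ⟶ z) [IsIso (f ≫ g)] : IsIso f := by
  have hr : f ≫ g ≫ inv (f ≫ g) = 𝟙 x := by rw [← Category.assoc, IsIso.hom_inv_id]
  have := hEI y ((g ≫ inv (f ≫ g)) ≫ f)
  have : IsSplitEpi f := .mk' ⟨inv ((g ≫ inv (f ≫ g)) ≫ f) ≫ g ≫ inv (f ≫ g), by
    rw [Category.assoc, IsIso.inv_hom_id]⟩
  have : Mono f := (SplitMono.mk _ hr).mono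
  exact isIso_of_mono_of_isSplitEpi f

/-- `Level j z` means that `z` is the target of a chain of `j` non-isomorphisms. -/
def Level : ℕ → C → Prop
  | 0 => fun _ ↦ True
  | j + 1 => fun z ↦ ¬ IsMinimalFor (Level j) z

lemma Level.map (hEI : ∀ (x : C) (f : x ⟶ x), IsIso f) {j : ℕ} {x z : C} (f : x ⟶ z)
    (hx : Level j x) : Level j z := by
  cases j with
  | zero => trivial
  | succ j =>
    intro hz
    refine hx fun y g hy ↦ ?_
    have := hz y (g ≫ f) hy
    exact isIso_of_isIso_comp hEI g f

lemma Level.exists_relSeries {j : ℕ} {z : C} (hz : Level j z) :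
    ∃ p : RelSeries {q : C × C | ∃ f : q.1 ⟶ q.2, ¬ IsIso f}, p.length = j ∧ p.last = z := by
  induction j generalizing z with
  | zero => exact ⟨RelSeries.singleton _ z, rfl, rfl⟩
  | succ j ih =>
    simp only [Level, IsMinimalFor, not_forall] at hz
    obtain ⟨x, f, hx, hf⟩ := hz
    obtain ⟨p, rfl, rfl⟩ := ih hx
    exact ⟨p.snoc z ⟨f, hf⟩, by simp, by simp⟩

lemma Level.le {n : ℕ}
    (hlen : ∀ (m : ℕ) (x : Fin (m + 1) → C) (f : ∀ i : Fin m, x i.castSucc ⟶ x i.succ),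
      (∀ i, ¬ IsIso (f i)) → m ≤ n) {j : ℕ} {z : C} (hz : Level j z) : j ≤ n := by
  obtain ⟨p, rfl, -⟩ := hz.exists_relSeries
  choose f hf using p.step
  exact hlen _ _ f hf

variable [∀ z : C, Fintype (Σ y : C, (y ≅ z))]

lemma hasProjectiveDimensionLT_of_supportedOn (hEI : ∀ (x : C) (f : x ⟶ x), IsIso f)
    {i j : ℕ} (hij : ∀ z : C, ¬ Level (i + j) z) {M : C ⥤ ModuleCat.{w} k}
    (hM : SupportedOn (Level j) M) {m : ℕ} (h : HasProjectiveDimensionLE M m) :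
    HasProjectiveDimensionLT M i := by
  induction i generalizing j M with
  | zero =>
    refine IsZero.hasProjectiveDimensionLT_zero ((Functor.isZero_iff M).2 fun z ↦ ?_)
    rw [ModuleCat.isZero_iff_subsingleton]
    exact hM z (by simpa using hij z)
  | succ i ih =>
    obtain ⟨P, π, hP, _, hK⟩ :=
      (isRelativelyProjective_of_hasProjectiveDimensionLE (fun _ _ f ↦ Level.map hEI f) hM
        h).exists_epi hM
    have hS : (ShortComplex.mk (kernel.ι π) π (by simp)).ShortExact :=
      { exact := ShortComplex.exact_of_f_is_kernel _ (kernelIsKernel _) }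
    have hm : HasProjectiveDimensionLE M (m + 1) :=
      hasProjectiveDimensionLT_of_ge M (m + 1) _ (by omega)
    have hP' : HasProjectiveDimensionLT P (i + 1) :=
      hasProjectiveDimensionLT_of_ge P 1 _ (by omega)
    exact hS.hasProjectiveDimensionLT_X₃ i
      (ih (j := j + 1) (fun z ↦ by simpa [add_assoc, add_comm 1] using hij z) hK
        ((hS.hasProjectiveDimensionLT_X₃_iff m hP).1 hm)) hP'

end Levels

end EIRepresentation

/-- **Lück's bound on the finitistic dimension of an EI category algebra.**
If `C` is a finite EI category in which every chain of composable non-isomorphisms has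
length at most `n`, then every representation `M : C ⥤ ModuleCat k` of finite projective
dimension has projective dimension at most `n`. -/
theorem finitistic_dimension_bound_of_EI
    (k : Type) [Field k] (C : Type) [SmallCategory C]
    [Fintype (Σ x : C, Σ y : C, x ⟶ y)]
    (hEI : ∀ (x : C) (f : x ⟶ x), IsIso f)
    (n : ℕ)
    (hlen : ∀ (m : ℕ) (x : Fin (m + 1) → C)
      (f : ∀ i : Fin m, x i.castSucc ⟶ x i.succ),
      (∀ i, ¬ IsIso (f i)) → m ≤ n)
    (M : C ⥤ ModuleCat k)
    (hM : ∃ m, HasProjDimLE M m) :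
    HasProjDimLE M n := by
  have hfin (z : C) : Finite (Σ y : C, (y ≅ z)) :=
    Finite.of_injective (fun p ↦ (⟨p.1, z, p.2.hom⟩ : Σ x : C, Σ y : C, x ⟶ y)) (by
      rintro ⟨y, g⟩ ⟨y', g'⟩ h
      obtain ⟨rfl, h⟩ := Sigma.mk.inj h
      congr 1
      ext
      simpa using h)
  have (z : C) : Fintype (Σ y : C, (y ≅ z)) := .ofFinite _
  obtain ⟨m, hm⟩ := hM
  exact EIRepresentation.hasProjDimLE_of_hasProjectiveDimensionLE
    (EIRepresentation.hasProjectiveDimensionLT_of_supportedOn hEI (i := n + 1) (j := 0)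
      (fun z hz ↦ by simpa using hz.le hlen) (fun z hz ↦ (hz trivial).elim)
      (EIRepresentation.hasProjectiveDimensionLE_of_hasProjDimLE hm))
end

section
/- Let k be a field and C a finite EI category such that for every object x the order of the automorphism group Aut(x) is invertible in k, and suppose every composable chain of non-isomorphisms in C has length at most n (i.e. ℓ(C) ≤ n). Then every representation M : C ⥤ ModuleCat k has projective dimension at most n; in particular the global dimension of kC is finite. -/
open CategoryTheory CategoryTheory.Limits

section Splicing

variable {A : Type*} [Category A] [Abelian A]

/-- A chain complex of projectives together with an exact augmentation is a projective
resolution. -/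
noncomputable def CategoryTheory.ProjectiveResolution.ofExact {Z : A} (K : ChainComplex A ℕ)
    (hK : ∀ n, Projective (K.X n)) (ε : K.X 0 ⟶ Z) (w : K.d 1 0 ≫ ε = 0)
    (hε : Epi ε) (h₀ : (ShortComplex.mk _ _ w).Exact)
    (h : ∀ n, (ShortComplex.mk _ _ (K.d_comp_d (n + 2) (n + 1) n)).Exact) :
    ProjectiveResolution Z where
  complex := K
  projective := hK
  π := (ChainComplex.toSingle₀Equiv _ _).symm ⟨ε, w⟩
  quasiIso := ⟨fun n => by
    cases n with
    | zero =>
      rw [ChainComplex.quasiIsoAt₀_iff, ShortComplex.quasiIso_iff_of_zeros']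
      · refine (ShortComplex.exact_and_epi_g_iff_of_iso ?_).2 ⟨h₀, hε⟩
        refine ShortComplex.isoMk (Iso.refl _) (Iso.refl _) (Iso.refl _) ?_ ?_
        · exact (Category.id_comp _).trans (Category.comp_id _).symm
        · refine (Category.id_comp _).trans (Eq.trans ?_ (Category.comp_id _).symm)
          simp
          rfl
      · exact K.shape _ _ (by simp)
      all_goals rfl
    | succ m =>
      rw [quasiIsoAt_iff_exactAt' _ _ (ChainComplex.exactAt_succ_single_obj _ _),
        HomologicalComplex.exactAt_iff' _ (m + 2) (m + 1) m (by simp) (by simp)]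
      exact h m⟩

/-- Splicing a projective resolution of the kernel of an epimorphism from a projective object
to a projective resolution of its target. -/
noncomputable def CategoryTheory.ShortComplex.ShortExact.spliceResolution {S : ShortComplex A}
    (hS : S.ShortExact) (h₂ : Projective S.X₂) {K : ChainComplex A ℕ}
    (hK : ∀ n, Projective (K.X n)) (ε : K.X 0 ⟶ S.X₁) (w : K.d 1 0 ≫ ε = 0)
    (hε : Epi ε) (h₀ : (ShortComplex.mk _ _ w).Exact)
    (h : ∀ n, (ShortComplex.mk _ _ (K.d_comp_d (n + 2) (n + 1) n)).Exact) :
    ProjectiveResolution S.X₃ :=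
  have := hS.mono_f
  ProjectiveResolution.ofExact
    (K.augment (ε ≫ S.f) (by rw [← Category.assoc, w, zero_comp]))
    (fun n => by
      cases n
      · exact h₂
      · exact hK _)
    S.g (by
      have hz : (ε ≫ S.f) ≫ S.g = 0 := by simp
      exact hz)
    hS.epi_g
    (by
      let α : ShortComplex.mk (ε ≫ S.f) S.g (by simp) ⟶ S :=
        { τ₁ := ε, τ₂ := 𝟙 _, τ₃ := 𝟙 _ }
      exact (ShortComplex.exact_iff_of_epi_of_isIso_of_mono α).2 hS.exact)
    (fun n => by
      cases n with
      | zero =>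
        let α : ShortComplex.mk _ _ w ⟶
            ShortComplex.mk (K.d 1 0) (ε ≫ S.f) (by rw [← Category.assoc, w, zero_comp]) :=
          { τ₁ := 𝟙 _, τ₂ := 𝟙 _, τ₃ := S.f }
        exact (ShortComplex.exact_iff_of_epi_of_isIso_of_mono α).1 h₀
      | succ m => exact h m)

theorem hasProjDimLE_of_hasProjectiveDimensionLE
    [EnoughProjectives A] (n : ℕ) (M : A) [HasProjectiveDimensionLE M n] : HasProjDimLE M n := by
  induction n generalizing M with
  | zero =>
    have : Projective M := (projective_iff_hasProjectiveDimensionLE_zero M).2 inferInstance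
    exact ⟨ProjectiveResolution.self M, fun i hi =>
      HomologicalComplex.isZero_single_obj_X _ _ _ _ (by simpa using hi.ne')⟩
  | succ n ih =>
    have hS : (ShortComplex.mk _ _ (kernel.condition (Projective.π M))).ShortExact :=
      { exact := ShortComplex.exact_kernel _ }
    have := (hS.hasProjectiveDimensionLT_X₃_iff n inferInstance).1 ‹_›
    obtain ⟨P, hP⟩ := ih (kernel (Projective.π M))
    refine ⟨hS.spliceResolution inferInstance P.projective (P.π.f 0)
      P.complex_d_comp_π_f_zero (inferInstanceAs (Epi (P.π.f 0))) P.exact₀ P.exact_succ,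
      fun i hi => ?_⟩
    obtain _ | i := i
    · omega
    · exact hP i (by omega)

end Splicing

section Truncation

universe u v

variable {k : Type u} [Field k] {C : Type*} [Category C]

/-- The largest submodule of `M.obj x` supported on the objects satisfying `S`. -/
def supportSubmodule (M : C ⥤ ModuleCat.{v} k) (S : C → Prop) (x : C) : Submodule k (M.obj x) :=
  ⨆ _ : S x, ⊤

/-- For `S` closed under morphisms, the subrepresentation of `M` which agrees with `M` on `S`
and vanishes outside of `S`. -/
def restrictSupport (M : C ⥤ ModuleCat.{v} k) {S : C → Prop}
    (hS : ∀ ⦃x y : C⦄, (x ⟶ y) → S x → S y) : C ⥤ ModuleCat.{v} k where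
  obj x := ModuleCat.of k (supportSubmodule M S x)
  map {x y} f := ModuleCat.ofHom ((M.map f).hom.restrict (p := supportSubmodule M S x)
    (q := supportSubmodule M S y) (by
      intro m hm
      by_cases h : S x
      · simp [supportSubmodule, hS f h]
      · simp only [supportSubmodule, h, iSup_neg, not_false_eq_true, Submodule.mem_bot] at hm
        simp [hm]))
  map_id x := by ext; simp
  map_comp f g := by ext; simp

/-- The inclusion of `restrictSupport M hS` into `M`. -/
def restrictSupportι (M : C ⥤ ModuleCat.{v} k) {S : C → Prop}
    (hS : ∀ ⦃x y : C⦄, (x ⟶ y) → S x → S y) : restrictSupport M hS ⟶ M where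
  app x := ModuleCat.ofHom (supportSubmodule M S x).subtype

variable (M : C ⥤ ModuleCat.{v} k) {S : C → Prop} (hS : ∀ ⦃x y : C⦄, (x ⟶ y) → S x → S y)

instance : Mono (restrictSupportι M hS) := by
  have (x : C) : Mono ((restrictSupportι M hS).app x) :=
    (ModuleCat.mono_iff_injective _).2 (supportSubmodule M S x).injective_subtype
  exact NatTrans.mono_of_mono_app _

theorem isZero_restrictSupport_obj {x : C} (hx : ¬ S x) :
    IsZero ((restrictSupport M hS).obj x) := by
  have : Subsingleton (supportSubmodule M S x) := by
    rw [supportSubmodule, iSup_neg hx]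
    infer_instance
  exact ModuleCat.isZero_of_subsingleton (ModuleCat.of k (supportSubmodule M S x))

theorem isZero_cokernel_restrictSupportι_obj {x : C} (hx : S x) :
    IsZero ((cokernel (restrictSupportι M hS)).obj x) := by
  have : Epi ((restrictSupportι M hS).app x) := by
    refine (ModuleCat.epi_iff_surjective _).2 fun m => ⟨⟨m, ?_⟩, rfl⟩
    simp [supportSubmodule, hx]
  refine IsZero.of_epi_eq_zero ((cokernel.π (restrictSupportι M hS)).app x) ?_
  rw [← cancel_epi ((restrictSupportι M hS).app x), ← NatTrans.comp_app, cokernel.condition]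
  simp

theorem shortExact_restrictSupport :
    (ShortComplex.mk _ _ (cokernel.condition (restrictSupportι M hS))).ShortExact :=
  { exact := ShortComplex.exact_cokernel _ }

end Truncation

section Projective

universe u v

variable {k : Type u} [Field k] {C : Type*} [Category C]

theorem isZero_sigma {ι D : Type*} [Category D] [HasZeroMorphisms D] (F : ι → D)
    [HasCoproduct F] (hF : ∀ i, IsZero (F i)) : IsZero (∐ F) :=
  (IsZero.iff_id_eq_zero _).2 (Sigma.hom_ext _ _ fun i => (hF i).eq_of_src _ _)

/-- Every representation of a finite category is a quotient of a projective representation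
supported on the objects reachable from its support. -/
theorem exists_projective_epi_with_support [Finite C] [∀ x y : C, Finite (x ⟶ y)]
    (M : C ⥤ ModuleCat.{v} k) :
    ∃ (Q : C ⥤ ModuleCat.{v} k) (p : Q ⟶ M), Projective Q ∧ Epi p ∧
      ∀ y, (∀ x, (x ⟶ y) → IsZero (M.obj x)) → IsZero (Q.obj y) := by
  let F (x : C) : C ⥤ ModuleCat.{v} k := (evaluationLeftAdjoint (ModuleCat.{v} k) x).obj (M.obj x)
  let c (x : C) : F x ⟶ M := (evaluationAdjunctionRight (ModuleCat.{v} k) x).counit.app M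
  have hF (x : C) : Projective (F x) :=
    (evaluationAdjunctionRight (ModuleCat.{v} k) x).map_projective _
      inferInstance
  refine ⟨∐ F, Sigma.desc c, ⟨fun f e _ => ⟨Sigma.desc fun x =>
    Projective.factorThru (Sigma.ι F x ≫ f) e, Sigma.hom_ext _ _ fun x => by simp⟩⟩, ?_, fun y hy => ?_⟩
  · have (y : C) : Epi ((Sigma.desc c).app y) := by
      have h₁ := (evaluationAdjunctionRight (ModuleCat.{v} k) y).right_triangle_components M
      have : Epi ((c y).app y) := epi_of_epi_fac h₁
      have h₂ : (Sigma.ι F y).app y ≫ (Sigma.desc c).app y = (c y).app y := by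
        rw [← NatTrans.comp_app, Sigma.ι_desc]
      exact epi_of_epi_fac h₂
    exact NatTrans.epi_of_epi_app _
  · refine IsZero.of_iso ?_ (PreservesCoproduct.iso ((evaluation C (ModuleCat.{v} k)).obj y) F)
    exact isZero_sigma _ fun x =>
      isZero_sigma (fun _ : x ⟶ y => M.obj x) fun f => hy x f

theorem enoughProjectives_functor_moduleCat [Finite C] [∀ x y : C, Finite (x ⟶ y)] :
    EnoughProjectives (C ⥤ ModuleCat.{v} k) where
  presentation M := by
    obtain ⟨Q, p, _, _, _⟩ := exists_projective_epi_with_support M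
    exact ⟨{ p := Q, f := p }⟩

end Projective

section Averaging

universe u v

variable {k : Type u} [Field k] {C : Type*} [Category C]

/-- An epimorphism between representations on which all non-isomorphisms act by zero is split,
if the orders of the automorphism groups are invertible. -/
theorem nonempty_splitEpi_of_map_eq_zero [∀ x y : C, Finite (x ⟶ y)]
    (hinv : ∀ x : C, ((Nat.card (Aut x) : k)) ≠ 0) {X Y : C ⥤ ModuleCat.{v} k} (p : X ⟶ Y) [Epi p]
    (hX : ∀ ⦃x y : C⦄ (f : x ⟶ y), ¬ IsIso f → X.map f = 0)
    (hY : ∀ ⦃x y : C⦄ (f : x ⟶ y), ¬ IsIso f → Y.map f = 0) :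
    Nonempty (SplitEpi p) := by
  classical
  have _ (x y : C) : Finite (x ≅ y) := Finite.of_injective Iso.hom fun _ _ h => Iso.ext h
  have _ (x y : C) : Fintype (x ≅ y) := Fintype.ofFinite _
  have hs (x : C) : ∃ s : Y.obj x ⟶ X.obj x, s ≫ p.app x = 𝟙 _ := by
    obtain ⟨s, hs⟩ := (p.app x).hom.exists_rightInverse_of_surjective
      (LinearMap.range_eq_top.2 ((ModuleCat.epi_iff_surjective _).1 inferInstance))
    exact ⟨ModuleCat.ofHom s, ModuleCat.hom_ext hs⟩
  choose s hs using hs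
  let T (r y : C) : Y.obj y ⟶ X.obj y := ∑ f : r ≅ y, Y.map f.inv ≫ s r ≫ X.map f.hom
  have T_naturality (r : C) {y z : C} (g : y ≅ z) : Y.map g.hom ≫ T r z = T r y ≫ X.map g.hom := by
    simp only [T, Preadditive.comp_sum, Preadditive.sum_comp]
    refine (Fintype.sum_equiv ((Iso.refl r).isoCongr g) _ _ fun f => ?_).symm
    have h : Y.map g.hom ≫ Y.map (f.trans g).inv = Y.map f.inv := by
      rw [← Functor.map_comp, Iso.trans_inv, g.hom_inv_id_assoc]
    have hf : (Iso.refl r).isoCongr g f = f.trans g := by ext; simp [Iso.isoCongr]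
    rw [hf, ← Category.assoc (Y.map g.hom), h, Iso.trans_hom, Functor.map_comp]
    simp only [Category.assoc]
  have T_app (r y : C) : T r y ≫ p.app y = (Nat.card (r ≅ y) : k) • 𝟙 (Y.obj y) := by
    have (f : r ≅ y) : (Y.map f.inv ≫ s r ≫ X.map f.hom) ≫ p.app y = 𝟙 _ := by
      rw [Category.assoc, Category.assoc, p.naturality, ← Category.assoc (s r), hs, Category.id_comp,
        ← Functor.map_comp, f.inv_hom_id, CategoryTheory.Functor.map_id]
    simp only [T, Preadditive.sum_comp, this]
    simp [Nat.cast_smul_eq_nsmul]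
  let r (y : C) : C := (Quotient.mk (isIsomorphicSetoid C) y).out
  have hr (y : C) : Nonempty (r y ≅ y) :=
    Quotient.mk_out (s := isIsomorphicSetoid C) y
  have hr_iso {y z : C} (g : y ≅ z) : r y = r z :=
    congrArg Quotient.out (Quotient.sound (s := isIsomorphicSetoid C) ⟨g⟩)
  have hcard (y : C) : (Nat.card (r y ≅ y) : k) ≠ 0 := by
    obtain ⟨e⟩ := hr y
    rw [Nat.card_congr (e.isoCongrLeft (Y := y))]
    exact hinv y
  let σ : Y ⟶ X :=
    { app y := (Nat.card (r y ≅ y) : k)⁻¹ • T (r y) y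
      naturality y z f := by
        by_cases hf : IsIso f
        · have h : Nat.card (r y ≅ y) = Nat.card (r z ≅ z) := by
            rw [← hr_iso (asIso f)]
            exact Nat.card_congr ((Iso.refl _).isoCongr (asIso f))
          rw [h, Linear.comp_smul, Linear.smul_comp, ← hr_iso (asIso f)]
          congr 1
          exact T_naturality _ (asIso f)
        · simp [hX f hf, hY f hf] }
  refine ⟨σ, ?_⟩
  ext y : 2
  have h : ((Nat.card (r y ≅ y) : k)⁻¹ • T (r y) y) ≫ p.app y = 𝟙 _ := by
    rw [Linear.smul_comp, T_app, smul_smul, inv_mul_cancel₀ (hcard y), one_smul]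
  exact h

end Averaging

section HeightFiltration

variable {C : Type*} [Category C]

/-- All chains of non-isomorphisms starting at the given object have length less than `h`. -/
def ChainLengthLT : ℕ → C → Prop
  | 0, _ => False
  | h + 1, x => ∀ ⦃y : C⦄ (f : x ⟶ y), ¬ IsIso f → ChainLengthLT h y

theorem ChainLengthLT.succ {h : ℕ} {x : C} (hx : ChainLengthLT h x) :
    ChainLengthLT (h + 1) x := by
  induction h generalizing x with
  | zero => exact hx.elim
  | succ h ih => exact fun y f hf => ih (hx f hf)

theorem ChainLengthLT.of_hom {h : ℕ} ⦃x y : C⦄ (f : x ⟶ y) (hx : ChainLengthLT h x) :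
    ChainLengthLT h y := by
  obtain _ | h := h
  · exact hx
  · by_cases hf : IsIso f
    · intro z g hg
      exact hx (f ≫ g) fun _ => hg (IsIso.of_isIso_comp_left f g)
    · exact (hx f hf).succ

theorem exists_relSeries_of_not_chainLengthLT {h : ℕ} {x : C} (hx : ¬ ChainLengthLT h x) :
    ∃ p : RelSeries {(x, y) : C × C | ∃ f : x ⟶ y, ¬ IsIso f}, p.length = h ∧ p.head = x := by
  induction h generalizing x with
  | zero => exact ⟨RelSeries.singleton _ x, rfl, rfl⟩
  | succ h ih =>
    rw [ChainLengthLT] at hx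
    push Not at hx
    obtain ⟨y, f, hf, hy⟩ := hx
    obtain ⟨p, hp, hpy⟩ := ih hy
    exact ⟨p.cons x (by rw [hpy]; exact ⟨f, hf⟩), by simp [hp], by simp⟩

theorem chainLengthLT_of_forall_length_le {n : ℕ}
    (hlen : ∀ (m : ℕ) (x : Fin (m + 1) → C) (f : ∀ i : Fin m, x i.castSucc ⟶ x i.succ),
      (∀ i, ¬ IsIso (f i)) → m ≤ n) (x : C) :
    ChainLengthLT (n + 1) x := by
  by_contra hx
  obtain ⟨p, hp, -⟩ := exists_relSeries_of_not_chainLengthLT hx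
  choose f hf using p.step
  have := hlen p.length p f hf
  omega

universe u v

variable {k : Type u} [Field k] [Finite C] [∀ x y : C, Finite (x ⟶ y)]

theorem hasProjectiveDimensionLT_of_support (hinv : ∀ x : C, ((Nat.card (Aut x) : k)) ≠ 0)
    (h : ℕ) (M : C ⥤ ModuleCat.{v} k) (hM : ∀ x, ¬ ChainLengthLT h x → IsZero (M.obj x)) :
    HasProjectiveDimensionLT M h := by
  induction h generalizing M with
  | zero =>
    exact (Functor.isZero_iff M).2 (fun x => hM x id) |>.hasProjectiveDimensionLT_zero
  | succ h ih =>
    have hS := ChainLengthLT.of_hom (C := C) (h := h)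
    have ih_sub (N : C ⥤ ModuleCat.{v} k) : HasProjectiveDimensionLT (restrictSupport N hS) h :=
      ih _ fun x hx => isZero_restrictSupport_obj N hS hx
    let top (N : C ⥤ ModuleCat.{v} k) : C ⥤ ModuleCat.{v} k := cokernel (restrictSupportι N hS)
    have isZero_top {N : C ⥤ ModuleCat.{v} k}
        (hN : ∀ x, ¬ ChainLengthLT (h + 1) x → IsZero (N.obj x)) (x : C)
        (hx : ¬ ChainLengthLT (h + 1) x) : IsZero ((top N).obj x) :=
      IsZero.of_epi ((cokernel.π (restrictSupportι N hS)).app x) (hN x hx)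
    have top_map {N : C ⥤ ModuleCat.{v} k}
        (hN : ∀ x, ¬ ChainLengthLT (h + 1) x → IsZero (N.obj x)) ⦃x y : C⦄ (f : x ⟶ y)
        (hf : ¬ IsIso f) : (top N).map f = 0 := by
      by_cases hx : ChainLengthLT (h + 1) x
      · exact (isZero_cokernel_restrictSupportι_obj N hS (hx f hf)).eq_of_tgt _ _
      · exact (isZero_top hN x hx).eq_of_src _ _
    suffices HasProjectiveDimensionLT (top M) (h + 1) from
      (shortExact_restrictSupport M hS).hasProjectiveDimensionLT_X₂ (h + 1)
        (have := ih_sub M; hasProjectiveDimensionLT_of_ge _ h _ h.le_succ) this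
    obtain ⟨Q, p, _, _, hQ⟩ := exists_projective_epi_with_support (top M)
    replace hQ : ∀ y, ¬ ChainLengthLT (h + 1) y → IsZero (Q.obj y) := fun y hy =>
      hQ y fun x f => isZero_top hM x fun hx => hy (hx.of_hom f)
    have hp : restrictSupportι Q hS ≫ p = 0 := by
      ext x : 2
      by_cases hx : ChainLengthLT h x
      · exact (isZero_cokernel_restrictSupportι_obj M hS hx).eq_of_tgt _ _
      · exact (isZero_restrictSupport_obj Q hS hx).eq_of_src _ _
    let q : top Q ⟶ top M := cokernel.desc _ p hp
    have : Epi q := epi_of_epi_fac (cokernel.π_desc _ p hp)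
    obtain ⟨s⟩ := nonempty_splitEpi_of_map_eq_zero hinv q (top_map hQ) (top_map hM)
    have : HasProjectiveDimensionLT (top Q) (h + 1) :=
      (shortExact_restrictSupport Q hS).hasProjectiveDimensionLT_X₃ h (ih_sub Q) inferInstance
    exact Retract.hasProjectiveDimensionLT ⟨s.section_, q, s.id⟩ (h + 1)

end HeightFiltration

/-- **Lück's bound on the global dimension of an EI category algebra.**
If `C` is a finite EI category such that the order of every automorphism group is
invertible in `k`, and every chain of composable non-isomorphisms has length at most `n`,
then every representation `M : C ⥤ ModuleCat k` has projective dimension at most `n`;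
in particular the global dimension of `kC` is finite. -/
theorem global_dimension_bound_of_EI
    (k : Type) [Field k] (C : Type) [SmallCategory C]
    [Fintype (Σ x : C, Σ y : C, x ⟶ y)]
    (hEI : ∀ (x : C) (f : x ⟶ x), IsIso f)
    (hinv : ∀ x : C, IsUnit ((Nat.card (Aut x) : k)))
    (n : ℕ)
    (hlen : ∀ (m : ℕ) (x : Fin (m + 1) → C)
      (f : ∀ i : Fin m, x i.castSucc ⟶ x i.succ),
      (∀ i, ¬ IsIso (f i)) → m ≤ n)
    (M : C ⥤ ModuleCat k) :
    HasProjDimLE M n := by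
  have : Finite C := Finite.of_injective
    (fun x : C => (⟨x, x, 𝟙 x⟩ : Σ x : C, Σ y : C, x ⟶ y)) fun x y h => congrArg Sigma.fst h
  have (x y : C) : Finite (x ⟶ y) := Finite.of_injective
    (fun f : x ⟶ y => (⟨x, y, f⟩ : Σ x : C, Σ y : C, x ⟶ y)) fun f g h => by simpa using h
  have := enoughProjectives_functor_moduleCat (k := k) (C := C)
  have := hasProjectiveDimensionLT_of_support (fun x => (hinv x).ne_zero) (n + 1) M
    fun x hx => (hx (chainLengthLT_of_forall_length_le hlen x)).elim
  exact hasProjDimLE_of_hasProjectiveDimensionLE n M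
end

section
/- Let k be a field and C a finite EI category. If there exists an object x of C such that the characteristic of k divides the order of Aut(x), then there exists a representation M : C ⥤ ModuleCat k of infinite projective dimension, i.e. M has projective dimension ≤ n for no natural number n. -/
open CategoryTheory CategoryTheory.Limits

universe v

section PeriodicExactness

variable {k : Type*} [CommRing k] {V W K : Type*} [AddCommGroup V] [Module k V]
  [AddCommGroup W] [Module k W] [AddCommGroup K] [Module k K]

/-- The two-periodic complex `V → V → V → ⋯` with differentials alternating between `φ - 1` and
`1 + φ + ⋯ + φ ^ (p - 1)` is exact. When `φ ^ p = 1`, this says that the Tate cohomology of the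
cyclic group of order `p` with coefficients in `V` vanishes. -/
structure IsTateAcyclic (p : ℕ) (φ : Module.End k V) : Prop where
  exists_sum_pow_eq : ∀ v, φ v = v → ∃ w, (∑ j ∈ Finset.range p, φ ^ j) w = v
  exists_sub_eq : ∀ v, (∑ j ∈ Finset.range p, φ ^ j) v = 0 → ∃ w, φ w - w = v

lemma Module.End.sum_pow_apply_map {φ : Module.End k V} {ψ : Module.End k W}
    (f : V →ₗ[k] W) (hf : ∀ v, f (φ v) = ψ (f v)) (p : ℕ) (v : V) :
    f ((∑ j ∈ Finset.range p, φ ^ j) v) = (∑ j ∈ Finset.range p, ψ ^ j) (f v) := by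
  have h : ∀ (j : ℕ) (v : V), f ((φ ^ j) v) = (ψ ^ j) (f v) := by
    intro j
    induction j with
    | zero => simp
    | succ j ih => intro v; rw [pow_succ, pow_succ, Module.End.mul_apply, Module.End.mul_apply,
        ih, hf]
  simp [LinearMap.sum_apply, h]

namespace IsTateAcyclic

variable {p : ℕ} {φ : Module.End k V} {ψ : Module.End k W} {χ : Module.End k K}

lemma of_retract (hψ : IsTateAcyclic p ψ) (s : V →ₗ[k] W) (r : W →ₗ[k] V)
    (hs : ∀ v, s (φ v) = ψ (s v)) (hr : ∀ w, r (ψ w) = φ (r w)) (hrs : ∀ v, r (s v) = v) :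
    IsTateAcyclic p φ where
  exists_sum_pow_eq v hv := by
    obtain ⟨w, hw⟩ := hψ.exists_sum_pow_eq (s v) (by rw [← hs, hv])
    exact ⟨r w, by rw [← Module.End.sum_pow_apply_map r hr, hw, hrs]⟩
  exists_sub_eq v hv := by
    obtain ⟨w, hw⟩ := hψ.exists_sub_eq (s v)
      (by rw [← Module.End.sum_pow_apply_map s hs, hv, map_zero])
    exact ⟨r w, by rw [← hr, ← map_sub, hw, hrs]⟩

lemma of_exact (hχ : IsTateAcyclic p χ) (hψ : IsTateAcyclic p ψ) (hpow : ψ ^ p = 1)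
    (i : K →ₗ[k] W) (q : W →ₗ[k] V) (hi : Function.Injective i) (hq : Function.Surjective q)
    (hiq : Function.Exact i q) (hiχ : ∀ a, i (χ a) = ψ (i a)) (hqψ : ∀ w, q (ψ w) = φ (q w)) :
    IsTateAcyclic p φ where
  exists_sum_pow_eq v hv := by
    obtain ⟨w, rfl⟩ := hq v
    obtain ⟨a, ha⟩ := (hiq (ψ w - w)).1 (by rw [map_sub, hqψ, hv, sub_self])
    have hN : (∑ j ∈ Finset.range p, ψ ^ j) (ψ w - w) = 0 := by
      have := LinearMap.congr_fun (geom_sum_mul ψ p) w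
      simpa [hpow, Module.End.mul_apply] using this
    obtain ⟨b, hb⟩ := hχ.exists_sub_eq a
      (hi (by rw [Module.End.sum_pow_apply_map i hiχ, ha, hN, map_zero]))
    obtain ⟨u, hu⟩ := hψ.exists_sum_pow_eq (w - i b) (by
      rw [map_sub, ← hiχ, ← sub_eq_zero]
      have : i (χ b) - i b = ψ w - w := by rw [← map_sub, hb, ha]
      rw [sub_sub_sub_comm, this, sub_self])
    refine ⟨q u, ?_⟩
    rw [← Module.End.sum_pow_apply_map q hqψ, hu, map_sub, hiq.apply_apply_eq_zero, sub_zero]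
  exists_sub_eq v hv := by
    obtain ⟨w, rfl⟩ := hq v
    obtain ⟨a, ha⟩ := (hiq ((∑ j ∈ Finset.range p, ψ ^ j) w)).1
      (by rw [Module.End.sum_pow_apply_map q hqψ, hv])
    have hN : ψ ((∑ j ∈ Finset.range p, ψ ^ j) w) = (∑ j ∈ Finset.range p, ψ ^ j) w := by
      have := LinearMap.congr_fun (mul_geom_sum ψ p) w
      rw [hpow, sub_self, sub_mul, one_mul, LinearMap.sub_apply, Module.End.mul_apply] at this
      exact sub_eq_zero.1 this
    obtain ⟨b, hb⟩ := hχ.exists_sum_pow_eq a (hi (by rw [hiχ, ha, hN]))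
    obtain ⟨u, hu⟩ := hψ.exists_sub_eq (w - i b) (by
      rw [map_sub, ← Module.End.sum_pow_apply_map i hiχ, hb, ha, sub_self])
    refine ⟨q u, ?_⟩
    rw [← hqψ, ← map_sub, hu, map_sub, hiq.apply_apply_eq_zero, sub_zero]

/-- Acyclicity follows from a contracting homotopy `θ`, as in Higman's criterion. -/
lemma of_homotopy (θ : Module.End k V)
    (hθ : ∑ j ∈ Finset.range p, φ ^ (p - j) * θ * φ ^ j = 1) : IsTateAcyclic p φ where
  exists_sum_pow_eq v hv := by
    have hpow : ∀ j : ℕ, (φ ^ j) v = v := by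
      intro j
      induction j with
      | zero => simp
      | succ j ih => rw [pow_succ, Module.End.mul_apply, hv, ih]
    refine ⟨φ (θ v), ?_⟩
    conv_rhs => rw [← Module.End.one_apply (R := k) v, ← hθ]
    rw [LinearMap.sum_apply, LinearMap.sum_apply, ← Finset.sum_range_reflect]
    refine Finset.sum_congr rfl fun j hj => ?_
    have hj' : p - j = p - 1 - j + 1 := by have := Finset.mem_range.1 hj; omega
    rw [Module.End.mul_apply, Module.End.mul_apply, hpow, hj', pow_succ, Module.End.mul_apply]
  exists_sub_eq v hv := by
    refine ⟨∑ j ∈ Finset.range p, (∑ l ∈ Finset.range (p - j), φ ^ l) (θ ((φ ^ j) v)), ?_⟩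
    have h₁ : ∑ j ∈ Finset.range p, θ ((φ ^ j) v) = 0 := by
      rw [← map_sum, ← LinearMap.sum_apply, hv, map_zero]
    conv_rhs => rw [← Module.End.one_apply (R := k) v, ← hθ]
    rw [map_sum, ← Finset.sum_sub_distrib, LinearMap.sum_apply]
    refine (add_zero _).symm.trans ?_
    rw [← h₁, ← Finset.sum_add_distrib]
    refine Finset.sum_congr rfl fun j _ => ?_
    have := LinearMap.congr_fun (mul_geom_sum φ (p - j)) (θ ((φ ^ j) v))
    rw [sub_mul, one_mul, LinearMap.sub_apply, LinearMap.sub_apply, Module.End.mul_apply,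
      Module.End.one_apply] at this
    rw [this, sub_add_cancel, Module.End.mul_apply, Module.End.mul_apply]

end IsTateAcyclic

lemma Equiv.Perm.exists_transversal {S : Type*} (σ : Equiv.Perm S) {p : ℕ} (hp : 0 < p)
    (hσ : σ ^ p = 1) (hfree : ∀ j, 0 < j → j < p → ∀ s, (σ ^ j) s ≠ s) :
    ∃ R : Set S, ∀ s, ∃ j < p, ∀ i < p, (σ ^ i) s ∈ R ↔ i = j := by
  let r : S → S := fun s => (Quotient.mk (Equiv.Perm.SameCycle.setoid σ) s).out
  have hr : ∀ s, σ.SameCycle s (r s) := fun s =>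
    (Quotient.exact (s := Equiv.Perm.SameCycle.setoid σ) (Quotient.out_eq _)).symm
  have hr' : ∀ (i : ℕ) s, r ((σ ^ i) s) = r s := fun i s =>
    congrArg Quotient.out (Quotient.sound (s := Equiv.Perm.SameCycle.setoid σ)
      (Equiv.Perm.sameCycle_pow_left.2 (Equiv.Perm.SameCycle.refl σ s)))
  have hinj : ∀ s (i j : ℕ), i < p → j < p → i < j → (σ ^ i) s ≠ (σ ^ j) s := by
    intro s i j _ hj hij h
    refine hfree (j - i) (by omega) (by omega) s ((σ ^ i).injective ?_)
    rw [← Equiv.Perm.mul_apply, ← pow_add, Nat.add_sub_cancel' hij.le, h]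
  refine ⟨{s | r s = s}, fun s => ?_⟩
  obtain ⟨z, hz⟩ := hr s
  have hp' : (0 : ℤ) < p := by exact_mod_cast hp
  have hmod : (((z % p).toNat : ℕ) : ℤ) = z % p := Int.toNat_of_nonneg (Int.emod_nonneg _ hp'.ne')
  have hlt : (z % p).toNat < p := by have := Int.emod_lt_of_pos z hp'; omega
  have hj : (σ ^ (z % p).toNat) s = r s := by
    rw [← hz, ← zpow_natCast, hmod]
    conv_rhs => rw [← Int.emod_add_mul_ediv z p, zpow_add, zpow_mul, zpow_natCast, hσ, one_zpow,
      mul_one]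
  refine ⟨(z % p).toNat, hlt, fun i hi => ?_⟩
  rw [Set.mem_ofPred_eq, hr', ← hj]
  constructor
  · intro h
    rcases lt_trichotomy i (z % p).toNat with h' | h' | h'
    · exact (hinj s _ _ hi hlt h' h.symm).elim
    · exact h'
    · exact (hinj s _ _ hlt hi h' h).elim
  · rintro rfl
    rfl

lemma Finsupp.lmapDomain_perm_pow {S : Type*} (σ : Equiv.Perm S) (j : ℕ) :
    (Finsupp.lmapDomain k k σ : Module.End k (S →₀ k)) ^ j = Finsupp.lmapDomain k k (σ ^ j) := by
  induction j with
  | zero => simp [Module.End.one_eq_id]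
  | succ j ih => rw [pow_succ, ih, pow_succ, Equiv.Perm.coe_mul, Finsupp.lmapDomain_comp]; rfl

lemma IsTateAcyclic.lmapDomain {S : Type*} (σ : Equiv.Perm S) {p : ℕ} (hp : 0 < p)
    (hσ : σ ^ p = 1) (hfree : ∀ j, 0 < j → j < p → ∀ s, (σ ^ j) s ≠ s) :
    IsTateAcyclic p (Finsupp.lmapDomain k k σ : Module.End k (S →₀ k)) := by
  classical
  obtain ⟨R, hR⟩ := σ.exists_transversal hp hσ hfree
  refine .of_homotopy (Finsupp.linearCombination k
    (fun s => if s ∈ R then Finsupp.single s (1 : k) else 0)) ?_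
  refine Finsupp.lhom_ext' fun s => LinearMap.ext_ring ?_
  obtain ⟨j, hjp, hj⟩ := hR s
  have hpj : (σ ^ (p - j)) ((σ ^ j) s) = s := by
    rw [← Equiv.Perm.mul_apply, ← pow_add, Nat.sub_add_cancel hjp.le, hσ, Equiv.Perm.one_apply]
  simp only [Finsupp.lmapDomain_perm_pow, LinearMap.comp_apply, LinearMap.sum_apply,
    Module.End.mul_apply, Finsupp.lsingle_apply, Finsupp.lmapDomain_apply,
    Finsupp.mapDomain_single, Finsupp.linearCombination_single, one_smul, Module.End.one_apply]
  rw [Finset.sum_eq_single_of_mem j (Finset.mem_range.2 hjp)]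
  · rw [if_pos ((hj j hjp).2 rfl), Finsupp.mapDomain_single, hpj]
  · intro i hi hij
    rw [if_neg fun h => hij ((hj i (Finset.mem_range.1 hi)).1 h), Finsupp.mapDomain_zero]

end PeriodicExactness

section FreeSigma

variable {C : Type} [SmallCategory C] (k : Type) [Field k] {I : Type v}

/-- The direct sum of the representable `k`-linear functors attached to a family of objects. -/
noncomputable def freeSigma (y : I → C) : C ⥤ ModuleCat.{v} k where
  obj z := ModuleCat.of k ((Σ i, (y i ⟶ z)) →₀ k)
  map f := ModuleCat.ofHom (Finsupp.lmapDomain k k fun s => ⟨s.1, s.2 ≫ f⟩)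
  map_id z := by
    refine ModuleCat.hom_ext (Finsupp.lhom_ext' fun s => LinearMap.ext_ring ?_)
    simp
  map_comp f g := by
    refine ModuleCat.hom_ext (Finsupp.lhom_ext' fun s => LinearMap.ext_ring ?_)
    simp

namespace freeSigma

variable {k} {y : I → C} {F : C ⥤ ModuleCat.{v} k}

/-- The basis vector of `freeSigma k y` at `z` given by a morphism `y i ⟶ z`. -/
noncomputable def mk {z : C} (i : I) (h : y i ⟶ z) : (freeSigma k y).obj z :=
  Finsupp.single (⟨i, h⟩ : Σ i, (y i ⟶ z)) (1 : k)

lemma map_mk {z w : C} (i : I) (h : y i ⟶ z) (f : z ⟶ w) :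
    (freeSigma k y).map f (mk i h) = mk i (h ≫ f) :=
  Finsupp.mapDomain_single

lemma app_hom_ext {z : C} {M : ModuleCat.{v} k} {f g : (freeSigma k y).obj z ⟶ M}
    (h : ∀ i (u : y i ⟶ z), f (mk i u) = g (mk i u)) : f = g :=
  ModuleCat.hom_ext (Finsupp.lhom_ext' fun s => LinearMap.ext_ring (h s.1 s.2))

lemma hom_ext {f g : freeSigma k y ⟶ F} (h : ∀ i, f.app _ (mk i (𝟙 _)) = g.app _ (mk i (𝟙 _))) :
    f = g := by
  ext1
  funext z
  refine app_hom_ext fun i u => ?_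
  have hu : (mk i u : (freeSigma k y).obj z) = (freeSigma k y).map u (mk i (𝟙 _)) := by
    rw [map_mk, Category.id_comp]
  rw [hu, NatTrans.naturality_apply, NatTrans.naturality_apply, h]

/-- The component at `z` of the morphism `freeSigma.desc a`. -/
noncomputable def descApp (a : ∀ i, F.obj (y i)) (z : C) : (freeSigma k y).obj z ⟶ F.obj z :=
  ModuleCat.ofHom
    (Finsupp.linearCombination k fun s : Σ i, (y i ⟶ z) => (F.map s.2 (a s.1) : F.obj z))

lemma descApp_mk (a : ∀ i, F.obj (y i)) {z : C} (i : I) (h : y i ⟶ z) :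
    descApp a z (mk i h) = F.map h (a i) :=
  (Finsupp.linearCombination_single _ _ _).trans (one_smul _ _)

/-- The morphism out of `freeSigma k y` given by a family of elements. -/
noncomputable def desc (a : ∀ i, F.obj (y i)) : freeSigma k y ⟶ F where
  app := descApp a
  naturality z w g := app_hom_ext fun i u => by
    rw [ConcreteCategory.comp_apply, ConcreteCategory.comp_apply, map_mk, descApp_mk, descApp_mk,
      Functor.map_comp_apply]

lemma desc_app_mk (a : ∀ i, F.obj (y i)) {z : C} (i : I) (h : y i ⟶ z) :
    (desc a).app z (mk i h) = F.map h (a i) :=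
  descApp_mk a i h

instance : Projective (freeSigma k y) where
  factors {E X} f e _ := by
    have he : ∀ i, ∃ a : E.obj (y i), e.app (y i) a = f.app (y i) (mk i (𝟙 _)) := fun i =>
      (ModuleCat.epi_iff_surjective (e.app (y i))).1 inferInstance _
    choose a ha using he
    refine ⟨desc a, hom_ext fun i => ?_⟩
    rw [NatTrans.comp_app, ConcreteCategory.comp_apply, desc_app_mk, Functor.map_id_apply, ha]

end freeSigma

end FreeSigma

section Support

variable {C : Type} [SmallCategory C] {k : Type} [Field k] {x : C}

/-- `F` vanishes on the objects that receive no morphism from `x`. -/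
def IsSupportedAbove (x : C) (F : C ⥤ ModuleCat.{v} k) : Prop :=
  ∀ z, IsEmpty (x ⟶ z) → Subsingleton (F.obj z)

lemma isSupportedAbove_freeSigma {I : Type v} {y : I → C} (hy : ∀ i, Nonempty (x ⟶ y i)) :
    IsSupportedAbove x (freeSigma k y) := by
  intro z hz
  have : IsEmpty (Σ i, (y i ⟶ z)) := ⟨fun s => hz.false ((hy s.1).some ≫ s.2)⟩
  exact inferInstanceAs (Subsingleton ((Σ i, (y i ⟶ z)) →₀ k))

lemma IsSupportedAbove.of_mono {F G : C ⥤ ModuleCat.{v} k} (hG : IsSupportedAbove x G)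
    (i : F ⟶ G) [Mono i] : IsSupportedAbove x F := by
  intro z hz
  have := hG z hz
  exact ((ModuleCat.mono_iff_injective (i.app z)).1 inferInstance).subsingleton

/-- A functor supported above `x` is a quotient of a sum of representables at objects above `x`. -/
lemma IsSupportedAbove.exists_epi_freeSigma {F : C ⥤ ModuleCat.{v} k} (hF : IsSupportedAbove x F) :
    ∃ (I : Type v) (y : I → C) (_ : ∀ i, Nonempty (x ⟶ y i)) (q : freeSigma k y ⟶ F), Epi q := by
  let I := Σ z : {z : C // Nonempty (x ⟶ z)}, F.obj z
  let y : I → C := fun i => i.1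
  refine ⟨I, y, fun i => i.1.2, freeSigma.desc fun i => i.2,
    (NatTrans.epi_iff_epi_app _).2 fun z => (ModuleCat.epi_iff_surjective _).2 fun v => ?_⟩
  by_cases hz : Nonempty (x ⟶ z)
  · refine ⟨freeSigma.mk (y := y) ⟨⟨z, hz⟩, v⟩ (𝟙 z), ?_⟩
    rw [freeSigma.desc_app_mk, Functor.map_id_apply]
  · have := hF z (not_nonempty_iff.1 hz)
    exact ⟨0, Subsingleton.elim _ _⟩

/-- The action of `Aut x` on the basis of `freeSigma k y` at `x`. -/
def sigmaHomPerm {I : Type v} (y : I → C) (x : C) : Aut x →* Equiv.Perm (Σ i, (y i ⟶ x)) :=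
  MonoidHom.toHomPerm
    { toFun g s := ⟨s.1, s.2 ≫ g.hom⟩
      map_one' := funext fun s => Sigma.ext rfl (heq_of_eq (Category.comp_id s.2))
      map_mul' _ _ := funext fun s => Sigma.ext rfl (heq_of_eq (Category.assoc s.2 _ _).symm) }

lemma map_pow_orderOf_freeSigma {I : Type v} (y : I → C) (g : Aut x) :
    (((freeSigma k y).map g.hom).hom : Module.End k _) ^ orderOf g = 1 := by
  refine (Finsupp.lmapDomain_perm_pow (sigmaHomPerm y x g) _).trans ?_
  rw [← map_pow, pow_orderOf_eq_one, map_one]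
  exact Finsupp.lmapDomain_id k k

lemma isTateAcyclic_freeSigma
    (hEI : ∀ (x : C) (f : x ⟶ x), IsIso f) {g : Aut x} (hg : IsOfFinOrder g)
    {I : Type v} {y : I → C} (hy : ∀ i, Nonempty (x ⟶ y i)) :
    IsTateAcyclic (orderOf g) ((freeSigma k y).map g.hom).hom := by
  refine IsTateAcyclic.lmapDomain (sigmaHomPerm y x g) hg.orderOf_pos
    (by rw [← map_pow, pow_orderOf_eq_one, map_one]) fun j hj hjg s hs => ?_
  rw [← map_pow] at hs
  obtain ⟨u⟩ := hy s.1
  have := hEI x (u ≫ s.2)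
  have : Epi s.2 := epi_of_epi u s.2
  have h : s.2 ≫ (g ^ j).hom = s.2 ≫ 𝟙 x := by
    rw [Category.comp_id]
    exact eq_of_heq (Sigma.ext_iff.1 hs).2
  exact pow_ne_one_of_lt_orderOf hj.ne' hjg (Iso.ext ((cancel_epi _).1 h))

lemma IsSupportedAbove.isTateAcyclic_of_projective {F : C ⥤ ModuleCat.{v} k}
    (hF : IsSupportedAbove x F) [Projective F]
    (hEI : ∀ (x : C) (f : x ⟶ x), IsIso f) {g : Aut x} (hg : IsOfFinOrder g) :
    IsTateAcyclic (orderOf g) (F.map g.hom).hom := by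
  obtain ⟨I, y, hy, q, _⟩ := hF.exists_epi_freeSigma
  have hs : Projective.factorThru (𝟙 F) q ≫ q = 𝟙 F := Projective.factorThru_comp _ _
  refine (isTateAcyclic_freeSigma (k := k) hEI hg hy).of_retract
    ((Projective.factorThru (𝟙 F) q).app x).hom (q.app x).hom
    (fun v => NatTrans.naturality_apply _ _ _) (fun v => NatTrans.naturality_apply _ _ _)
    (fun v => ?_)
  exact ConcreteCategory.congr_hom (NatTrans.congr_app hs x) v

lemma IsSupportedAbove.isTateAcyclic_of_hasProjectiveDimensionLT
    (hEI : ∀ (x : C) (f : x ⟶ x), IsIso f) {g : Aut x} (hg : IsOfFinOrder g) (n : ℕ)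
    {F : C ⥤ ModuleCat.{v} k} (hF : IsSupportedAbove x F)
    (hn : HasProjectiveDimensionLT F (n + 1)) :
    IsTateAcyclic (orderOf g) (F.map g.hom).hom := by
  induction n generalizing F with
  | zero =>
    have : Projective F := projective_iff_hasProjectiveDimensionLT_one.2 hn
    exact hF.isTateAcyclic_of_projective hEI hg
  | succ n ih =>
    obtain ⟨I, y, hy, q, _⟩ := hF.exists_epi_freeSigma
    have hS : (ShortComplex.mk _ _ (kernel.condition q)).ShortExact :=
      { exact := ShortComplex.exact_kernel q }
    have hK := ih ((isSupportedAbove_freeSigma hy).of_mono (kernel.ι q))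
      ((hS.hasProjectiveDimensionLT_X₃_iff n inferInstance).1 hn)
    have hSx := hS.map_of_exact ((evaluation C (ModuleCat k)).obj x)
    exact hK.of_exact (isTateAcyclic_freeSigma hEI hg hy) (map_pow_orderOf_freeSigma y g)
      ((kernel.ι q).app x).hom (q.app x).hom hSx.moduleCat_injective_f hSx.moduleCat_surjective_g
      ((ShortComplex.ShortExact.moduleCat_exact_iff_function_exact _).1 hSx.exact)
      (fun v => NatTrans.naturality_apply _ _ _) (fun v => NatTrans.naturality_apply _ _ _)

end Support

/-- The functor whose value is `k` at the objects above `x` and zero elsewhere. -/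
noncomputable def constAbove (k : Type) [Field k] {C : Type} [SmallCategory C] (x : C) :
    C ⥤ ModuleCat.{v} k where
  obj z := ModuleCat.of k (ULift.{v} (PLift (Nonempty (x ⟶ z))) →₀ k)
  map f := ModuleCat.ofHom (Finsupp.lmapDomain k k fun h => ⟨⟨h.down.down.map (· ≫ f)⟩⟩)
  map_id z := by
    refine ModuleCat.hom_ext (Finsupp.lhom_ext' fun s => LinearMap.ext_ring ?_)
    simp
  map_comp f g := by
    refine ModuleCat.hom_ext (Finsupp.lhom_ext' fun s => LinearMap.ext_ring ?_)
    simp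

lemma HasProjDimLE.hasProjectiveDimensionLT {A : Type*} [Category A] [Abelian A]
    {M : A} {n : ℕ} (h : HasProjDimLE M n) : HasProjectiveDimensionLT M (n + 1) := by
  let := HasExt.standard A
  obtain ⟨P, hP⟩ := h
  refine .mk fun i hi Y e => ?_
  obtain ⟨f, hf, rfl⟩ := P.extMk_surjective e (i + 1) rfl
  obtain rfl : f = 0 := (hP i hi).eq_of_src _ _
  exact P.extMk_zero _ _

/-- If the characteristic of `k` divides the order of some automorphism group of a finite
EI category `C`, then some representation of `C` has infinite projective dimension. -/
theorem exists_infinite_projective_dimension_of_char_dvd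
    (k : Type) [Field k] (C : Type) [SmallCategory C]
    [Fintype (Σ x : C, Σ y : C, x ⟶ y)]
    (hEI : ∀ (x : C) (f : x ⟶ x), IsIso f)
    (hchar : ∃ x : C, (ringChar k) ∣ Nat.card (Aut x)) :
    ∃ M : C ⥤ ModuleCat k, ∀ n : ℕ, ¬ HasProjDimLE M n := by
  obtain ⟨x, hx⟩ := hchar
  have : Finite (Aut x) := Finite.of_injective
    (fun g : Aut x => (⟨x, x, g.hom⟩ : Σ x : C, Σ y : C, x ⟶ y)) fun g h hgh => by
      simp only [Sigma.mk.injEq, heq_eq_eq, true_and] at hgh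
      exact Iso.ext hgh
  have : NeZero (ringChar k) := ⟨fun h => Nat.card_pos.ne' (zero_dvd_iff.1 (h ▸ hx))⟩
  have : Fact (ringChar k).Prime := ⟨CharP.char_is_prime_of_pos k (ringChar k) |>.out⟩
  obtain ⟨g, hg⟩ := exists_prime_orderOf_dvd_card' (ringChar k) hx
  have hF : IsSupportedAbove x (constAbove k x) := by
    intro z hz
    have : IsEmpty (ULift (PLift (Nonempty (x ⟶ z)))) := ⟨fun h => hz.false h.down.down.some⟩
    exact inferInstanceAs (Subsingleton (ULift (PLift (Nonempty (x ⟶ z))) →₀ k))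
  refine ⟨constAbove k x, fun n hn => ?_⟩
  have hT := hF.isTateAcyclic_of_hasProjectiveDimensionLT hEI (isOfFinOrder_of_finite g) n
    hn.hasProjectiveDimensionLT
  have hid : ((constAbove k x).map g.hom).hom = (1 : Module.End k _) := by
    refine Finsupp.lhom_ext' fun s => LinearMap.ext_ring ?_
    exact Finsupp.mapDomain_single
  obtain ⟨w, hw⟩ := hT.exists_sum_pow_eq
    (Finsupp.single (⟨⟨⟨𝟙 x⟩⟩⟩ : ULift (PLift (Nonempty (x ⟶ x)))) (1 : k))
    (by rw [hid]; rfl)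
  rw [hid, hg] at hw
  simp only [one_pow, Finset.sum_const, Finset.card_range, LinearMap.smul_apply,
    Module.End.one_apply] at hw
  rw [← Nat.cast_smul_eq_nsmul k, ringChar.Nat.cast_ringChar, zero_smul] at hw
  exact one_ne_zero (Finsupp.single_eq_zero.1 hw.symm)
end
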